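/- Let B be a real Banach space and let P ⊆ B be a cone: a nonempty closed convex subset with c·x ∈ P for all c ≥ 0 and x ∈ P, and P ∩ (−P) = {0}. Let 0 < r₁ < r₂, let Ω₁ and Ω₂ be the open balls in B of radii r₁ and r₂ centered at the origin, and let A : P ∩ (closure(Ω₂) \ Ω₁) → P be completely continuous (continuous with relatively compact image). Assume: (C1) ‖Ax‖ ≤ ‖x‖ for all x ∈ P with ‖x‖ = r₁; and (C2) there exists φ ∈ P, φ ≠ 0, such that x ≠ Ax + μ·φ for all x ∈ P with ‖x‖ = r₂ and all μ > 0. Then A has a fixed point x ∈ P with r₁ ≤ ‖x‖ ≤ r₂. The same conclusion holds if instead (C1) holds for all x ∈ P with ‖x‖ = r₂ and (C2) holds for all x ∈ P with ‖x‖ = r₁. -/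

import Mathlib

open Set Metric

/-- A finite set is dominant for a family of rankings when every point is, in at least one
ranking, at most all elements of the set. -/
def Dominant {V I L : Type*} [LinearOrder L] (u : I → V → L) (S : Finset V) : Prop :=
  ∀ y, ∃ i, ∀ x ∈ S, u i y ≤ u i x

theorem Dominant.mono {V I L : Type*} [LinearOrder L] {u : I → V → L} {S T : Finset V}
    (h : Dominant u S) (hTS : T ⊆ S) : Dominant u T := fun y =>
  (h y).imp fun _ hi x hx => hi x (hTS hx)

open Classical in
/-- A dominant set with one element fewer than the number of rankings extends in exactly two ways
to a dominant set with one more element, provided it is not on the boundary. -/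
theorem Dominant.card_extensions {V I L : Type*} [Fintype V] [Fintype I] [LinearOrder L]
    {u : I → V → L} (hu : ∀ i, Function.Injective (u i)) {T : Finset V}
    (hcard : T.card + 1 = Fintype.card I) (hne : T.Nonempty) (hT : Dominant u T)
    (hext : ∀ d, ∃ y, ∀ k, k ≠ d → ∃ t ∈ T, u k t < u k y) :
    (Finset.univ.filter fun y => y ∉ T ∧ Dominant u (insert y T)).card = 2 := by
  choose m hmT hm using fun k => Finset.exists_min_image T (u k) hne
  have hsurj : ∀ t ∈ T, ∃ k, t = m k := by
    intro t ht
    obtain ⟨k, hk⟩ := hT t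
    exact ⟨k, hu k (le_antisymm (hk _ (hmT k)) (hm k t ht))⟩
  obtain ⟨i, -, j, -, hij, hmij⟩ := Finset.exists_ne_map_eq_of_card_lt_of_maps_to
    (s := (Finset.univ : Finset I)) (t := T) (f := m)
    (by rw [Finset.card_univ]; omega) (fun k _ => hmT k)
  have hbest : ∀ d, ∃ y, (∀ k, k ≠ d → ∃ t ∈ T, u k t < u k y) ∧
      ∀ z, (∀ k, k ≠ d → ∃ t ∈ T, u k t < u k z) → u d z ≤ u d y := by
    intro d
    obtain ⟨y, hy, hmax⟩ := Finset.exists_max_image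
      (Finset.univ.filter fun y => ∀ k, k ≠ d → ∃ t ∈ T, u k t < u k y) (u d)
      (by obtain ⟨y, hy⟩ := hext d; exact ⟨y, by simpa using hy⟩)
    refine ⟨y, (Finset.mem_filter.1 hy).2, fun z hz => hmax z ?_⟩
    exact Finset.mem_filter.2 ⟨Finset.mem_univ _, hz⟩
  choose b hb hbmax using hbest
  have hlow : ∀ d, ∀ t ∈ T, u d (b d) ≤ u d t := by
    intro d
    obtain ⟨k, hk⟩ := hT (b d)
    by_cases hkd : k = d
    · exact hkd ▸ hk
    · obtain ⟨t, ht, hlt⟩ := hb d k hkd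
      exact absurd (hk t ht) (not_le.2 hlt)
  have hmem : ∀ d, d = i ∨ d = j → b d ∉ T ∧ Dominant u (insert (b d) T) := by
    intro d hd
    constructor
    · intro hbT
      have : ∃ k, k ≠ d ∧ b d = m k := by
        obtain ⟨k, hk⟩ := hsurj _ hbT
        by_cases hkd : k = d
        · subst hkd
          rcases hd with rfl | rfl
          · exact ⟨j, hij.symm, hk.trans hmij⟩
          · exact ⟨i, hij, hk.trans hmij.symm⟩
        · exact ⟨k, hkd, hk⟩
      obtain ⟨k, hkd, hk⟩ := this
      obtain ⟨t, ht, hlt⟩ := hb d k hkd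
      rw [hk] at hlt
      exact absurd (hm k t ht) (not_le.2 hlt)
    · intro z
      by_cases hz : ∀ k, k ≠ d → ∃ t ∈ T, u k t < u k z
      · refine ⟨d, fun x hx => ?_⟩
        rcases Finset.mem_insert.1 hx with rfl | hx
        · exact hbmax d z hz
        · exact (hbmax d z hz).trans (hlow d x hx)
      · push Not at hz
        obtain ⟨k, hkd, hk⟩ := hz
        refine ⟨k, fun x hx => ?_⟩
        rcases Finset.mem_insert.1 hx with rfl | hx
        · obtain ⟨t, ht, hlt⟩ := hb d k hkd
          exact (hk t ht).trans hlt.le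
        · exact hk x hx
  have hbne : b i ≠ b j := by
    intro h
    obtain ⟨t, ht, hlt⟩ := hb i j hij.symm
    rw [h] at hlt
    exact absurd (hlow j t ht) (not_le.2 hlt)
  rw [Finset.card_eq_two]
  refine ⟨b i, b j, hbne, ?_⟩
  ext y
  simp only [Finset.mem_filter, Finset.mem_univ, true_and, Finset.mem_insert,
    Finset.mem_singleton]
  refine ⟨fun ⟨hyT, hy⟩ => ?_, ?_⟩
  · choose m' hm'S hm' using fun k =>
      Finset.exists_min_image (insert y T) (u k) (Finset.insert_nonempty y T)
    have hsurj' : ∀ t ∈ insert y T, ∃ k, m' k = t := by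
      intro t ht
      obtain ⟨k, hk⟩ := hy t
      exact ⟨k, hu k (le_antisymm (hm' k t ht) (hk _ (hm'S k)))⟩
    have hinj : Set.InjOn m' (Finset.univ : Finset I) := by
      refine Finset.injOn_of_surjOn_of_card_le (t := insert y T) m' (fun k _ => hm'S k) ?_ ?_
      · intro t ht
        obtain ⟨k, hk⟩ := hsurj' t ht
        exact ⟨k, by simp, hk⟩
      · rw [Finset.card_insert_of_notMem hyT, Finset.card_univ, hcard]
    obtain ⟨d, hd⟩ := hsurj' y (Finset.mem_insert_self _ _)
    have hne' : ∀ k, k ≠ d → m' k ∈ T := by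
      intro k hk
      refine (Finset.mem_insert.1 (hm'S k)).resolve_left fun h => hk ?_
      exact hinj (by simp) (by simp) (h.trans hd.symm)
    have hmm : ∀ k, k ≠ d → m' k = m k := fun k hk =>
      hu k (le_antisymm (hm' k _ (Finset.mem_insert_of_mem (hmT k))) (hm k _ (hne' k hk)))
    have hyd : ∀ k, k ≠ d → ∃ t ∈ T, u k t < u k y := by
      intro k hk
      refine ⟨m' k, hne' k hk, lt_of_le_of_ne (hm' k y (Finset.mem_insert_self _ _)) ?_⟩
      intro h
      exact hyT (hu k h ▸ hne' k hk)
    have hdij : d = i ∨ d = j := by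
      by_contra! h
      exact hij (hinj (by simp) (by simp)
        (by rw [hmm i h.1.symm, hmm j h.2.symm, hmij]))
    have hyb : y = b d := by
      refine hu d (le_antisymm (hbmax d y hyd) ?_)
      obtain ⟨k, hk⟩ := hy (b d)
      by_cases hkd : k = d
      · exact hkd ▸ hk y (Finset.mem_insert_self _ _)
      · obtain ⟨t, ht, hlt⟩ := hb d k hkd
        exact absurd (hk t (Finset.mem_insert_of_mem ht)) (not_le.2 hlt)
    rcases hdij with rfl | rfl
    · exact Or.inl hyb
    · exact Or.inr hyb
  · rintro (rfl | rfl)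
    · exact hmem _ (Or.inl rfl)
    · exact hmem _ (Or.inr rfl)

open Classical in
/-- In a set with as many elements as colours whose colours repeat, an even number of elements
can be removed to leave exactly the colours other than `i₀`. -/
theorem even_card_facets {V I : Type*} [Fintype I] {S : Finset V}
    (hcard : S.card = Fintype.card I) (c : V → I) (i₀ : I) (hc : ¬ Set.InjOn c S) :
    Even (S.filter fun x => (S.erase x).image c = Finset.univ.erase i₀).card := by
  rcases (S.filter fun x => (S.erase x).image c = Finset.univ.erase i₀).eq_empty_or_nonempty
    with h | ⟨x, hx⟩
  · rw [h]; simp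
  obtain ⟨hxS, hx⟩ := Finset.mem_filter.1 hx
  have hinj : Set.InjOn c (S.erase x) := by
    rw [← Finset.card_image_iff, hx, Finset.card_erase_of_mem (Finset.mem_univ _),
      Finset.card_erase_of_mem hxS, hcard, Finset.card_univ]
  have hcx : c x ∈ (S.erase x).image c := by
    by_contra h
    refine hc ?_
    rw [← Finset.insert_erase hxS, Finset.coe_insert, Set.injOn_insert (by simp)]
    exact ⟨hinj, by rwa [← Finset.coe_image, Finset.mem_coe]⟩
  obtain ⟨x', hx', hcx'⟩ := Finset.mem_image.1 hcx
  have hxx' : x ≠ x' := (Finset.ne_of_mem_erase hx').symm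
  have hx'S := Finset.mem_of_mem_erase hx'
  have himg : (S.erase x').image c = (S.erase x).image c := by
    ext a
    simp only [Finset.mem_image, Finset.mem_erase]
    constructor
    · rintro ⟨z, ⟨hz, hzS⟩, rfl⟩
      by_cases hzx : z = x
      · exact ⟨x', ⟨hxx'.symm, hx'S⟩, by rw [hzx, hcx']⟩
      · exact ⟨z, ⟨hzx, hzS⟩, rfl⟩
    · rintro ⟨z, ⟨hz, hzS⟩, rfl⟩
      by_cases hzx : z = x'
      · exact ⟨x, ⟨hxx', hxS⟩, by rw [hzx, hcx']⟩
      · exact ⟨z, ⟨hzx, hzS⟩, rfl⟩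
  have : (S.filter fun x => (S.erase x).image c = Finset.univ.erase i₀) = {x, x'} := by
    ext z
    simp only [Finset.mem_filter, Finset.mem_insert, Finset.mem_singleton]
    constructor
    · rintro ⟨hzS, hz⟩
      by_contra! hne
      have : c z ∈ (S.erase z).image c := by
        rw [hz, ← hx]
        exact Finset.mem_image_of_mem c (Finset.mem_erase.2 ⟨hne.1, hzS⟩)
      obtain ⟨w, hw, hwz⟩ := Finset.mem_image.1 this
      by_cases hwx : w = x
      · subst hwx
        exact hne.2 (hinj (Finset.mem_erase.2 ⟨hne.1, hzS⟩) hx' (hwz.symm.trans hcx'.symm))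
      · exact Finset.ne_of_mem_erase hw
          (hinj (Finset.mem_erase.2 ⟨hwx, Finset.mem_of_mem_erase hw⟩)
            (Finset.mem_erase.2 ⟨hne.1, hzS⟩) hwz)
    · rintro (rfl | rfl)
      · exact ⟨hxS, hx⟩
      · exact ⟨hx'S, himg.trans hx⟩
  rw [this, Finset.card_pair hxx']
  exact even_two

open Classical in
/-- The vertices `e i` are the corners: `e i` is last in ranking `i` and ahead of all non-corner
vertices in the other rankings. The face opposite to the corner `e i₀` has exactly one dominant
extension. -/
theorem card_extensions_corners {V I L : Type*} [Fintype V] [Fintype I]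
    [LinearOrder L] {u : I → V → L} (hu : ∀ i, Function.Injective (u i)) {e : I → V}
    (hbot : ∀ i y, u i (e i) ≤ u i y)
    (htop : ∀ i j, i ≠ j → ∀ y ∉ Set.range e, u i y < u i (e j))
    (hX : ∃ x, x ∉ Set.range e) (i₀ : I) :
    (Finset.univ.filter fun y => y ∉ (Finset.univ.erase i₀).image e ∧
      Dominant u (insert y ((Finset.univ.erase i₀).image e))).card = 1 := by
  have hlt : ∀ i y, y ∉ Set.range e → u i (e i) < u i y := fun i y hy =>
    lt_of_le_of_ne (hbot i y) fun h => hy ⟨i, hu i h⟩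
  obtain ⟨b, hb, hmax⟩ := Finset.exists_max_image
    (Finset.univ.filter fun y => y ∉ Set.range e) (u i₀)
    (by obtain ⟨y, hy⟩ := hX; exact ⟨y, Finset.mem_filter.2 ⟨Finset.mem_univ _, hy⟩⟩)
  replace hb := (Finset.mem_filter.1 hb).2
  replace hmax : ∀ y ∉ Set.range e, u i₀ y ≤ u i₀ b := fun y hy =>
    hmax y (Finset.mem_filter.2 ⟨Finset.mem_univ _, hy⟩)
  rw [Finset.card_eq_one]
  refine ⟨b, ?_⟩
  ext y
  simp only [Finset.mem_filter, Finset.mem_univ, true_and, Finset.mem_singleton]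
  constructor
  · rintro ⟨hyT, hy⟩
    have hyX : y ∉ Set.range e := by
      rintro ⟨k, rfl⟩
      have hk : k = i₀ := by
        by_contra h
        exact hyT (Finset.mem_image_of_mem e (by simpa using h))
      subst hk
      obtain ⟨i, hi⟩ := hy b
      refine absurd (hi (e i) ?_) (not_le.2 (hlt i b hb))
      by_cases h : i = k
      · simp [h]
      · exact Finset.mem_insert_of_mem (Finset.mem_image_of_mem e (by simpa using h))
    obtain ⟨i, hi⟩ := hy b
    by_cases h : i = i₀
    · subst h
      exact hu i (le_antisymm (hmax y hyX) (hi y (Finset.mem_insert_self _ _)))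
    · exact absurd (hi (e i) (Finset.mem_insert_of_mem
        (Finset.mem_image_of_mem e (by simpa using h)))) (not_le.2 (hlt i b hb))
  · rintro rfl
    refine ⟨fun h => ?_, fun z => ?_⟩
    · obtain ⟨k, -, hk⟩ := Finset.mem_image.1 h
      exact hb ⟨k, hk⟩
    · by_cases hz : z ∈ Set.range e
      · obtain ⟨k, rfl⟩ := hz
        exact ⟨k, fun x _ => hbot k x⟩
      · refine ⟨i₀, fun x hx => ?_⟩
        rcases Finset.mem_insert.1 hx with rfl | hx
        · exact hmax z hz
        · obtain ⟨k, hk, rfl⟩ := Finset.mem_image.1 hx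
          exact (htop i₀ k (Finset.ne_of_mem_erase hk).symm z hz).le

open Classical in
/-- Scarf lemma: any colouring that colours the corner `e i` with `i` admits a dominant set on
which the colouring is a bijection onto the colours. -/
theorem exists_dominant_injOn {V I L : Type*} [Fintype V] [Fintype I] [Nonempty I]
    [LinearOrder L] {u : I → V → L} (hu : ∀ i, Function.Injective (u i)) {e : I → V}
    (hbot : ∀ i y, u i (e i) ≤ u i y)
    (htop : ∀ i j, i ≠ j → ∀ y ∉ Set.range e, u i y < u i (e j))
    (hX : ∃ x, x ∉ Set.range e) (c : V → I) (hc : ∀ i, c (e i) = i) :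
    ∃ S : Finset V, Dominant u S ∧ S.card = Fintype.card I ∧ Set.InjOn c S := by
  obtain ⟨i₀⟩ := ‹Nonempty I›
  by_contra! hno
  have he : Function.Injective e := Function.LeftInverse.injective hc
  let rooms : Finset (Finset V) :=
    Finset.univ.filter fun S => Dominant u S ∧ S.card = Fintype.card I
  let doors : Finset (Finset V) := Finset.univ.filter fun T =>
    T.card + 1 = Fintype.card I ∧ T.image c = Finset.univ.erase i₀
  have hcount : ∑ S ∈ rooms,
      (S.filter fun x => (S.erase x).image c = Finset.univ.erase i₀).card =
      ∑ T ∈ doors, (Finset.univ.filter fun y => y ∉ T ∧ Dominant u (insert y T)).card := by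
    rw [← Finset.card_sigma, ← Finset.card_sigma]
    refine Finset.card_bij' (fun p _ => ⟨p.1.erase p.2, p.2⟩) (fun p _ => ⟨insert p.2 p.1, p.2⟩)
      ?_ ?_ ?_ ?_
    · rintro ⟨S, x⟩ h
      simp only [rooms, doors, Finset.mem_sigma, Finset.mem_filter, Finset.mem_univ,
        true_and] at h ⊢
      obtain ⟨⟨hS, hScard⟩, hxS, hx⟩ := h
      refine ⟨⟨?_, hx⟩, by simp, by rwa [Finset.insert_erase hxS]⟩
      rw [Finset.card_erase_add_one hxS, hScard]
    · rintro ⟨T, y⟩ h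
      simp only [rooms, doors, Finset.mem_sigma, Finset.mem_filter, Finset.mem_univ,
        true_and] at h ⊢
      obtain ⟨⟨hTcard, hT⟩, hyT, hy⟩ := h
      refine ⟨⟨hy, ?_⟩, by simp, by rwa [Finset.erase_insert hyT]⟩
      rw [Finset.card_insert_of_notMem hyT, hTcard]
    · rintro ⟨S, x⟩ h
      simp only [Finset.mem_sigma, Finset.mem_filter] at h
      simp [Finset.insert_erase h.2.1]
    · rintro ⟨T, y⟩ h
      simp only [Finset.mem_sigma, Finset.mem_filter] at h
      simp [Finset.erase_insert h.2.2.1]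
  have hrooms : Even (∑ S ∈ rooms,
      (S.filter fun x => (S.erase x).image c = Finset.univ.erase i₀).card) := by
    refine Finset.even_sum _ fun S hS => ?_
    obtain ⟨hS, hcard⟩ := (Finset.mem_filter.1 hS).2
    exact even_card_facets hcard c i₀ (hno S hS hcard)
  have hcorner : (Finset.univ.erase i₀).image e ∈ doors := by
    refine Finset.mem_filter.2 ⟨Finset.mem_univ _, ?_, ?_⟩
    · rw [Finset.card_image_of_injective _ he, Finset.card_erase_add_one (Finset.mem_univ _),
        Finset.card_univ]
    · rw [Finset.image_image]
      simp [Function.comp_def, hc]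
  have hdoors : Even (∑ T ∈ doors.erase ((Finset.univ.erase i₀).image e),
      (Finset.univ.filter fun y => y ∉ T ∧ Dominant u (insert y T)).card) := by
    refine Finset.even_sum _ fun T hT => ?_
    obtain ⟨hTne, hT⟩ := Finset.mem_erase.1 hT
    obtain ⟨hcard, himg⟩ := (Finset.mem_filter.1 hT).2
    by_cases hdom : Dominant u T
    · have hx : ∃ x ∈ T, x ∉ Set.range e := by
        by_contra! h
        refine hTne (Finset.eq_of_subset_of_card_le (fun x hx => ?_) ?_)
        · obtain ⟨k, rfl⟩ := h x hx
          refine Finset.mem_image_of_mem e ?_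
          rw [← himg]
          exact Finset.mem_image.2 ⟨_, hx, hc k⟩
        · rw [Finset.card_image_of_injective _ he, ← himg]
          exact Finset.card_image_le
      obtain ⟨x, hxT, hx⟩ := hx
      rw [hdom.card_extensions hu hcard ⟨x, hxT⟩ fun d =>
        ⟨e d, fun k hk => ⟨x, hxT, htop k d hk x hx⟩⟩]
      exact even_two
    · rw [Finset.filter_false_of_mem fun y _ h => hdom (h.2.mono (Finset.subset_insert y T))]
      simp
  rw [hcount, ← Finset.add_sum_erase _ _ hcorner,
    card_extensions_corners hu hbot htop hX i₀] at hrooms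
  rw [Nat.even_add] at hrooms
  exact absurd (hrooms.2 hdoors) (by decide)

open Filter Topology in
/-- A continuous self-map of a closed set with relatively compact image that moves some points
arbitrarily little has a fixed point. -/
theorem exists_fixedPoint_of_forall_dist_lt {E : Type*} [MetricSpace E] {C K : Set E}
    (hC : IsClosed C) (hK : IsCompact K) {f : E → E} (hf : ContinuousOn f C)
    (hfK : MapsTo f C K) (h : ∀ ε > 0, ∃ x ∈ C, dist (f x) x < ε) : ∃ x ∈ C, f x = x := by
  choose x hxC hx using fun n : ℕ => h (1 / ((n : ℝ) + 1)) Nat.one_div_pos_of_nat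
  obtain ⟨y, -, φ, hφ, hy⟩ := hK.tendsto_subseq fun n => hfK (hxC n)
  have hdist : Tendsto (fun n => dist (f (x (φ n))) (x (φ n))) atTop (𝓝 0) :=
    squeeze_zero (fun _ => dist_nonneg) (fun n => (hx (φ n)).le)
      (tendsto_one_div_add_atTop_nhds_zero_nat.comp hφ.tendsto_atTop)
  have hxy : Tendsto (fun n => x (φ n)) atTop (𝓝 y) :=
    (tendsto_iff_of_dist hdist).1 hy
  have hyC : y ∈ C := hC.mem_of_tendsto hxy (Eventually.of_forall fun n => hxC _)
  refine ⟨y, hyC, tendsto_nhds_unique ?_ hy⟩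
  exact (hf y hyC).tendsto.comp
    (tendsto_nhdsWithin_iff.2 ⟨hxy, Eventually.of_forall fun n => hxC _⟩)

/-- A finite net in the standard simplex that is fine enough contains, for every colouring, a
small fully coloured cluster: a lower bound `a` for the cluster, attaining every colour in its
support. -/
theorem exists_cluster_of_net {I : Type*} [Fintype I] [Nonempty I] {X : Finset (I → ℝ)}
    (hX : ∀ x ∈ X, x ∈ stdSimplex ℝ I) (hXne : X.Nonempty) {ε : ℝ}
    (hnet : ∀ p ∈ stdSimplex ℝ I, ∃ x ∈ X, dist p x < ε) (c : (I → ℝ) → I) :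
    ∃ (a : I → ℝ) (s : ℝ) (σ : Finset (I → ℝ)), σ ⊆ X ∧ σ.Nonempty ∧
      s < Fintype.card I * ε ∧ (∀ x ∈ σ, ∀ i, a i ≤ x i ∧ x i ≤ a i + s) ∧
      ∀ i, a i = 0 ∨ ∃ x ∈ σ, c x = i := by
  classical
  let V := X ⊕ I
  let g : I → V → ℝ := fun i => Sum.elim (fun x => x.1 i) (fun j => if j = i then -1 else 2)
  let u : I → V → ℝ ×ₗ Fin (Fintype.card V) := fun i v => toLex (g i v, Fintype.equivFin V v)
  have hu : ∀ i, Function.Injective (u i) := fun i v w h =>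
    (Fintype.equivFin V).injective (congrArg Prod.snd (toLex.injective h))
  have hule : ∀ i v w, u i v ≤ u i w → g i v ≤ g i w := by
    intro i v w h
    rcases (Prod.Lex.toLex_le_toLex).1 h with h | h
    · exact h.le
    · exact h.1.le
  have hult : ∀ i v w, g i v < g i w → u i v < u i w := fun i v w h =>
    (Prod.Lex.toLex_lt_toLex).2 (Or.inl h)
  have hx0 : ∀ x : X, ∀ i, 0 ≤ x.1 i := fun x i => (hX _ x.2).1 i
  have hx1 : ∀ x : X, ∀ i, x.1 i ≤ 1 := fun x i => (mem_Icc_of_mem_stdSimplex (hX _ x.2) i).2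
  have hrange : ∀ y : V, y ∉ Set.range (Sum.inr : I → V) → ∃ x : X, y = Sum.inl x := by
    rintro (x | j) h
    · exact ⟨x, rfl⟩
    · exact absurd ⟨j, rfl⟩ h
  obtain ⟨x₀, hx₀⟩ := hXne
  obtain ⟨S, hS, hcard, hinj⟩ := exists_dominant_injOn (V := V) (I := I) hu (e := Sum.inr)
    (by
      rintro i (x | j)
      · refine (hult _ _ _ ?_).le
        have := hx0 x i
        simp only [g, Sum.elim_inl, Sum.elim_inr, if_true]
        linarith
      · by_cases h : j = i
        · rw [h]
        · refine (hult _ _ _ ?_).le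
          simp only [g, Sum.elim_inr, if_true, if_neg h]
          norm_num)
    (by
      intro i j hij y hy
      obtain ⟨x, rfl⟩ := hrange y hy
      refine hult _ _ _ ?_
      have := hx1 x i
      simp only [g, Sum.elim_inl, Sum.elim_inr, if_neg hij.symm]
      linarith)
    ⟨Sum.inl ⟨x₀, hx₀⟩, by simp⟩ (Sum.elim (fun x => c x.1) id) (fun _ => rfl)
  have hsurj : ∀ i, ∃ v ∈ S, (Sum.elim (fun x => c x.1) id : V → I) v = i := by
    intro i
    have := Finset.surjOn_of_injOn_of_card_le (s := S) (t := (Finset.univ : Finset I))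
      (Sum.elim (fun x => c x.1) id : V → I) (fun _ _ => by simp) hinj
      (by rw [Finset.card_univ, hcard])
    exact this (by simp : i ∈ ((Finset.univ : Finset I) : Set I))
  let σ : Finset (I → ℝ) := X.filter fun x => ∃ h : x ∈ X, Sum.inl ⟨x, h⟩ ∈ S
  have hmemσ : ∀ x : X, Sum.inl x ∈ S → x.1 ∈ σ := fun x hx =>
    Finset.mem_filter.2 ⟨x.2, x.2, hx⟩
  have hcol : ∀ i, (Sum.inr i : V) ∈ S ∨ ∃ x ∈ σ, c x = i := by
    intro i
    obtain ⟨v | j, hv, rfl⟩ := hsurj i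
    · exact Or.inr ⟨v.1, hmemσ v hv, rfl⟩
    · exact Or.inl hv
  have hdom : ∀ y ∈ X, ∃ i, (Sum.inr i : V) ∉ S ∧ ∀ x ∈ σ, y i ≤ x i := by
    intro y hy
    obtain ⟨i, hi⟩ := hS (Sum.inl ⟨y, hy⟩)
    refine ⟨i, fun h => ?_, fun x hx => ?_⟩
    · have h1 := hule _ _ _ (hi _ h)
      have h2 := hx0 ⟨y, hy⟩ i
      simp only [g, Sum.elim_inl, Sum.elim_inr, if_true] at h1 h2
      linarith
    · obtain ⟨-, hxX, hxS⟩ := Finset.mem_filter.1 hx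
      exact hule _ _ _ (hi _ hxS)
  have hσne : σ.Nonempty := by
    obtain ⟨i, hi, -⟩ := hdom x₀ hx₀
    obtain ⟨x, hx, -⟩ := (hcol i).resolve_left hi
    exact ⟨x, hx⟩
  have hσX : σ ⊆ X := Finset.filter_subset _ _
  choose b hbσ hb using fun i => Finset.exists_min_image σ (fun x => x i) hσne
  let a : I → ℝ := fun i => if (Sum.inr i : V) ∈ S then 0 else b i i
  have ha0 : ∀ i, 0 ≤ a i := by
    intro i
    by_cases h : (Sum.inr i : V) ∈ S
    · simp [a, h]
    · simpa [a, h] using (hX _ (hσX (hbσ i))).1 i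
  have hax : ∀ x ∈ σ, ∀ i, a i ≤ x i := by
    intro x hx i
    by_cases h : (Sum.inr i : V) ∈ S
    · simpa [a, h] using (hX _ (hσX hx)).1 i
    · simpa [a, h] using hb i x hx
  have hn : (0 : ℝ) < Fintype.card I := by exact_mod_cast Fintype.card_pos
  let s : ℝ := 1 - ∑ i, a i
  have hxs : ∀ x ∈ σ, ∑ i, (x i - a i) = s := by
    intro x hx
    rw [Finset.sum_sub_distrib, (hX _ (hσX hx)).2]
  have hs : 0 ≤ s := by
    obtain ⟨x, hx⟩ := hσne
    rw [← hxs x hx]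
    exact Finset.sum_nonneg fun i _ => sub_nonneg.2 (hax x hx i)
  refine ⟨a, s, σ, hσX, hσne, ?_, fun x hx i => ⟨hax x hx i, ?_⟩, fun i => ?_⟩
  · obtain ⟨y, hy, hdist⟩ := hnet (fun i => a i + s / Fintype.card I)
      ⟨fun i => add_nonneg (ha0 i) (div_nonneg hs hn.le), by
        rw [Finset.sum_add_distrib, Finset.sum_const, Finset.card_univ, nsmul_eq_mul,
          mul_div_cancel₀ _ hn.ne']
        simp [s]⟩
    obtain ⟨i, hi, hyi⟩ := hdom y hy
    have h1 : y i ≤ a i := by simpa [a, hi] using hyi (b i) (hbσ i)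
    have h2 := (dist_le_pi_dist (fun i => a i + s / Fintype.card I) y i).trans_lt hdist
    rw [Real.dist_eq] at h2
    have h3 := (abs_lt.1 h2).2
    have h4 : s / Fintype.card I < ε := by linarith
    rwa [div_lt_iff₀' hn] at h4
  · have := Finset.single_le_sum (f := fun j => x j - a j)
      (fun j _ => sub_nonneg.2 (hax x hx j)) (Finset.mem_univ i)
    rw [hxs x hx] at this
    linarith
  · rcases hcol i with h | h
    · exact Or.inl (by simp [a, h])
    · exact Or.inr h

/-- The Brouwer fixed point theorem for the standard simplex. -/
theorem exists_fixedPoint_stdSimplex {I : Type*} [Fintype I] [Nonempty I]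
    {f : (I → ℝ) → I → ℝ} (hf : ContinuousOn f (stdSimplex ℝ I))
    (hmaps : MapsTo f (stdSimplex ℝ I) (stdSimplex ℝ I)) : ∃ x ∈ stdSimplex ℝ I, f x = x := by
  classical
  have hcpt := isCompact_stdSimplex ℝ I
  refine exists_fixedPoint_of_forall_dist_lt hcpt.isClosed hcpt hf hmaps fun η hη => ?_
  have hn : (0 : ℝ) < Fintype.card I := by exact_mod_cast Fintype.card_pos
  suffices h : ∃ x ∈ stdSimplex ℝ I, ∀ i, x i - η / (2 * Fintype.card I) ≤ f x i by
    obtain ⟨x, hx, hfx⟩ := h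
    refine ⟨x, hx, lt_of_le_of_lt ?_ (half_lt_self hη)⟩
    have hδ : (0 : ℝ) ≤ η / (2 * Fintype.card I) := by positivity
    have hsum : ∑ i, (f x i - x i + η / (2 * Fintype.card I)) = η / 2 := by
      rw [Finset.sum_add_distrib, Finset.sum_sub_distrib, (hmaps hx).2, hx.2, Finset.sum_const,
        Finset.card_univ, nsmul_eq_mul]
      field_simp
      ring
    refine (dist_pi_le_iff (by positivity)).2 fun i => ?_
    have h1 := Finset.single_le_sum (f := fun j => f x j - x j + η / (2 * Fintype.card I))
      (fun j _ => by have := hfx j; linarith) (Finset.mem_univ i)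
    rw [hsum] at h1
    have h2 := hfx i
    have h3 : η / (2 * Fintype.card I) ≤ η / 2 := by
      have : (1 : ℝ) ≤ Fintype.card I := by exact_mod_cast Fintype.card_pos
      exact div_le_div_of_nonneg_left hη.le two_pos (by linarith)
    rw [Real.dist_eq, abs_le]
    constructor <;> linarith
  generalize hγ : η / (2 * Fintype.card I) = γ
  have hγ0 : 0 < γ := by rw [← hγ]; positivity
  obtain ⟨δ, hδ, hunif⟩ := Metric.uniformContinuousOn_iff.1
    (hcpt.uniformContinuousOn_of_continuous hf) (γ / 2) (half_pos hγ0)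
  obtain ⟨t, htsub, htfin, htcov⟩ := hcpt.finite_cover_balls
    (e := min (δ / 2) (γ / 2) / Fintype.card I) (by positivity)
  have hcol : ∀ x : I → ℝ, ∃ i, x ∈ stdSimplex ℝ I → x i ≤ f x i := by
    intro x
    by_cases hx : x ∈ stdSimplex ℝ I
    · obtain ⟨i, -, hi⟩ := Finset.exists_le_of_sum_le (s := Finset.univ) (f := x) (g := f x)
        Finset.univ_nonempty (by rw [hx.2, (hmaps hx).2])
      exact ⟨i, fun _ => hi⟩
    · exact ⟨Classical.arbitrary I, fun h => absurd h hx⟩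
  choose c hc using hcol
  have hnet : ∀ p ∈ stdSimplex ℝ I, ∃ x ∈ htfin.toFinset,
      dist p x < min (δ / 2) (γ / 2) / Fintype.card I := by
    intro p hp
    obtain ⟨x, hx, hpx⟩ := Set.mem_iUnion₂.1 (htcov hp)
    exact ⟨x, htfin.mem_toFinset.2 hx, hpx⟩
  have hne : htfin.toFinset.Nonempty := by
    obtain ⟨x, hx, -⟩ := hnet _ (single_mem_stdSimplex ℝ (Classical.arbitrary I))
    exact ⟨x, hx⟩
  have hsub : ∀ x ∈ htfin.toFinset, x ∈ stdSimplex ℝ I := fun x hx =>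
    htsub (htfin.mem_toFinset.1 hx)
  obtain ⟨a, s, σ, hσ, ⟨x, hx⟩, hs, hclose, hcolour⟩ := exists_cluster_of_net hsub hne hnet c
  rw [mul_div_cancel₀ _ hn.ne', lt_min_iff] at hs
  refine ⟨x, hsub x (hσ hx), fun i => ?_⟩
  have hxi := (hclose x hx i).2
  rcases hcolour i with h | ⟨z, hz, rfl⟩
  · have := (hmaps (hsub x (hσ hx))).1 i
    linarith
  · have hzx : dist z x < δ := by
      refine ((dist_pi_le_iff (r := δ / 2) (by positivity)).2 fun j => ?_).trans_lt
        (half_lt_self hδ)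
      have h1 := hclose x hx j
      have h2 := hclose z hz j
      rw [Real.dist_eq, abs_le]
      constructor <;> linarith
    have h1 := (dist_le_pi_dist (f z) (f x) (c z)).trans_lt
      (hunif z (hsub z (hσ hz)) x (hsub x (hσ hx)) hzx)
    rw [Real.dist_eq] at h1
    have h2 := (abs_lt.1 h1).2
    have h3 := hc z (hsub z (hσ hz))
    have h4 := (hclose z hz (c z)).1
    linarith

/-- The Schauder fixed point theorem. -/
theorem exists_fixedPoint_of_mapsTo_compact {E : Type*} [NormedAddCommGroup E] [NormedSpace ℝ E]
    {C K : Set E} (hC : IsClosed C) (hconv : Convex ℝ C) (hne : C.Nonempty) (hK : IsCompact K)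
    {f : E → E} (hf : ContinuousOn f C) (hfC : MapsTo f C C) (hfK : MapsTo f C K) :
    ∃ x ∈ C, f x = x := by
  have hfKC : MapsTo f C (K ∩ C) := fun x hx => ⟨hfK hx, hfC hx⟩
  have hKC : IsCompact (K ∩ C) := hK.inter_right hC
  refine exists_fixedPoint_of_forall_dist_lt hC hK hf hfK fun η hη => ?_
  suffices h : ∀ ε > 0, ∃ x ∈ C, dist (f x) x ≤ ε by
    obtain ⟨x, hx, hfx⟩ := h (η / 2) (half_pos hη)
    exact ⟨x, hx, hfx.trans_lt (half_lt_self hη)⟩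
  intro ε hε
  obtain ⟨t, htsub, htfin, htcov⟩ := hKC.finite_cover_balls hε
  have : Fintype t := htfin.fintype
  have hnet : ∀ y ∈ K ∩ C, ∃ v : t, dist y v < ε := by
    intro y hy
    obtain ⟨v, hv, hyv⟩ := Set.mem_iUnion₂.1 (htcov hy)
    exact ⟨⟨v, hv⟩, hyv⟩
  have : Nonempty t := by
    obtain ⟨x, hx⟩ := hne
    obtain ⟨v, -⟩ := hnet _ (hfKC hx)
    exact ⟨v⟩
  let w : t → E → ℝ := fun v y => max 0 (ε - dist y v)
  have hw : ∀ v, Continuous (w v) := fun v => by fun_prop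
  have hw0 : ∀ v y, 0 ≤ w v y := fun v y => le_max_left _ _
  have hW : ∀ y ∈ K ∩ C, 0 < ∑ v, w v y := by
    intro y hy
    obtain ⟨v, hv⟩ := hnet y hy
    exact Finset.sum_pos' (fun v _ => hw0 v y)
      ⟨v, Finset.mem_univ _, lt_max_of_lt_right (sub_pos.2 hv)⟩
  let p : (t → ℝ) → E := fun τ => ∑ v, τ v • (v : E)
  have hp : Continuous p := by fun_prop
  have hpC : MapsTo p (stdSimplex ℝ t) C := fun τ hτ =>
    hconv.sum_mem (fun v _ => hτ.1 v) hτ.2 fun v _ => (htsub v.2).2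
  have hfp : ContinuousOn (fun τ => f (p τ)) (stdSimplex ℝ t) := hf.comp hp.continuousOn hpC
  obtain ⟨τ, hτ, hfix⟩ := exists_fixedPoint_stdSimplex
    (f := fun τ v => w v (f (p τ)) / ∑ v', w v' (f (p τ)))
    (continuousOn_pi.2 fun v => ((hw v).comp_continuousOn hfp).div
      (continuousOn_finsetSum _ fun v _ => (hw v).comp_continuousOn hfp)
      fun τ hτ => (hW _ (hfKC (hpC hτ))).ne')
    (fun τ hτ => ⟨fun v => div_nonneg (hw0 _ _) (hW _ (hfKC (hpC hτ))).le, by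
      rw [← Finset.sum_div, div_self (hW _ (hfKC (hpC hτ))).ne']⟩)
  refine ⟨p τ, hpC hτ, ?_⟩
  have hsub : f (p τ) - p τ = ∑ v, τ v • (f (p τ) - (v : E)) := by
    simp only [smul_sub, Finset.sum_sub_distrib, ← Finset.sum_smul, hτ.2, one_smul, p]
  rw [dist_eq_norm, hsub]
  calc ‖∑ v, τ v • (f (p τ) - (v : E))‖ ≤ ∑ v, τ v * ε := by
        refine norm_sum_le_of_le _ fun v _ => ?_
        rw [norm_smul, Real.norm_of_nonneg (hτ.1 v), ← dist_eq_norm]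
        rcases le_or_gt (dist (f (p τ)) (v : E)) ε with h | h
        · exact mul_le_mul_of_nonneg_left h (hτ.1 v)
        · have : τ v = 0 := by
            rw [← congrFun hfix v]
            simp [w, max_eq_left (sub_nonpos.2 h.le)]
          simp [this]
    _ = ε := by rw [← Finset.sum_mul, hτ.2, one_mul]

/-- The radial retraction onto the closed ball of radius `r` about the origin. -/
noncomputable def radialRetraction {E : Type*} [NormedAddCommGroup E] [NormedSpace ℝ E]
    (r : ℝ) (y : E) : E :=
  (r / max r ‖y‖) • y

theorem continuous_radialRetraction {E : Type*} [NormedAddCommGroup E] [NormedSpace ℝ E]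
    {r : ℝ} (hr : 0 < r) : Continuous (radialRetraction r : E → E) :=
  (continuous_const.div (by fun_prop) fun _ => (lt_max_of_lt_left hr).ne').smul continuous_id

theorem radialRetraction_of_norm_le {E : Type*} [NormedAddCommGroup E] [NormedSpace ℝ E]
    {r : ℝ} (hr : 0 < r) {y : E} (hy : ‖y‖ ≤ r) : radialRetraction r y = y := by
  rw [radialRetraction, max_eq_left hy, div_self hr.ne', one_smul]

theorem norm_radialRetraction_of_le {E : Type*} [NormedAddCommGroup E] [NormedSpace ℝ E]
    {r : ℝ} (hr : 0 < r) {y : E} (hy : r ≤ ‖y‖) : ‖radialRetraction r y‖ = r := by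
  rw [radialRetraction, max_eq_right hy, norm_smul, Real.norm_of_nonneg (by positivity),
    div_mul_cancel₀ _ (hr.trans_le hy).ne']

theorem norm_radialRetraction_le {E : Type*} [NormedAddCommGroup E] [NormedSpace ℝ E]
    {r : ℝ} (hr : 0 < r) (y : E) : ‖radialRetraction r y‖ ≤ r := by
  rcases le_total ‖y‖ r with h | h
  · rwa [radialRetraction_of_norm_le hr h]
  · exact (norm_radialRetraction_of_le hr h).le

open Filter Topology in
/-- The compression form of the Krasnoselskii fixed point theorem, in a closed convex set stable
under nonnegative scaling. -/
theorem exists_fixedPoint_of_compression {E : Type*} [NormedAddCommGroup E] [NormedSpace ℝ E]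
    {P K : Set E} (hPclosed : IsClosed P) (hPconvex : Convex ℝ P)
    (hPsmul : ∀ c : ℝ, 0 ≤ c → ∀ x ∈ P, c • x ∈ P) {r₁ r₂ : ℝ} (hr₁ : 0 < r₁) (hr : r₁ < r₂)
    {A : E → E} (hK : IsCompact K)
    (hmap : MapsTo A (P ∩ (closedBall 0 r₂ \ ball 0 r₁)) P)
    (hmapK : MapsTo A (P ∩ (closedBall 0 r₂ \ ball 0 r₁)) K)
    (hcont : ContinuousOn A (P ∩ (closedBall 0 r₂ \ ball 0 r₁)))
    (houter : ∀ x ∈ P, ‖x‖ = r₂ → ‖A x‖ ≤ ‖x‖) {φ : E} (hφP : φ ∈ P) (hφ : φ ≠ 0)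
    (hinner : ∀ x ∈ P, ‖x‖ = r₁ → ∀ μ : ℝ, 0 < μ → x ≠ A x + μ • φ) :
    ∃ x ∈ P, A x = x ∧ r₁ ≤ ‖x‖ ∧ ‖x‖ ≤ r₂ := by
  have hr₂ : 0 < r₂ := hr₁.trans hr
  have hann : ∀ x, x ∈ P ∩ (closedBall 0 r₂ \ ball 0 r₁) ↔ x ∈ P ∧ r₁ ≤ ‖x‖ ∧ ‖x‖ ≤ r₂ := by
    intro x
    simp only [mem_inter_iff, Set.mem_sdiff, mem_closedBall, dist_zero_right, mem_ball, not_lt]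
    tauto
  have hPadd : ∀ x ∈ P, ∀ y ∈ P, x + y ∈ P := by
    intro x hx y hy
    have := hPsmul 2 two_pos.le _ (hPconvex hx hy (a := 1 / 2) (b := 1 / 2)
      (by norm_num) (by norm_num) (by norm_num))
    rwa [smul_add, smul_smul, smul_smul, mul_one_div_cancel two_ne_zero, one_smul,
      one_smul] at this
  have h0P : (0 : E) ∈ P := by simpa using hPsmul 0 le_rfl φ hφP
  let α : E → ℝ := fun x => min 1 (‖x‖ / r₁)
  let T : E → E := fun x => α x • A ((α x)⁻¹ • x) + (1 - α x) • φ
  have hα : Continuous α := by fun_prop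
  have hα1 : ∀ x, α x ≤ 1 := fun x => min_le_left _ _
  have hα0 : ∀ x, 0 ≤ α x := fun x => le_min zero_le_one (by positivity)
  have hαpos : ∀ x, x ≠ 0 → 0 < α x := fun x hx =>
    lt_min one_pos (div_pos (norm_pos_iff.2 hx) hr₁)
  have hαout : ∀ x, r₁ ≤ ‖x‖ → α x = 1 := fun x hx =>
    min_eq_left ((one_le_div hr₁).2 hx)
  have hαin : ∀ x, ‖x‖ ≤ r₁ → α x = ‖x‖ / r₁ := fun x hx =>
    min_eq_right ((div_le_one hr₁).2 hx)
  have hα00 : α 0 = 0 := by simp [α]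
  have hTout : ∀ x, r₁ ≤ ‖x‖ → T x = A x := fun x hx => by simp [T, hαout x hx]
  have hT0 : T 0 = φ := by simp [T, hα00]
  have hscale : ∀ x ∈ P ∩ closedBall 0 r₂, x ≠ 0 →
      (α x)⁻¹ • x ∈ P ∩ (closedBall 0 r₂ \ ball 0 r₁) := by
    rintro x ⟨hxP, hx⟩ hx0
    rw [mem_closedBall, dist_zero_right] at hx
    refine (hann _).2 ⟨hPsmul _ (inv_nonneg.2 (hα0 x)) x hxP, ?_⟩
    rcases le_total r₁ ‖x‖ with h | h
    · simp [hαout x h, h, hx]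
    · have : ‖(α x)⁻¹ • x‖ = r₁ := by
        have hx' := norm_pos_iff.2 hx0
        rw [norm_smul, Real.norm_of_nonneg (inv_nonneg.2 (hα0 x)), hαin x h]
        field_simp
      rw [this]
      exact ⟨le_rfl, hr.le⟩
  have hTP : MapsTo T (P ∩ closedBall 0 r₂) P := by
    intro x hx
    by_cases hx0 : x = 0
    · rwa [hx0, hT0]
    · exact hPadd _ (hPsmul _ (hα0 x) _ (hmap (hscale x hx hx0))) _
        (hPsmul _ (sub_nonneg.2 (hα1 x)) _ hφP)
  obtain ⟨M, hM⟩ := hK.isBounded.exists_norm_le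
  have hTcont : ContinuousOn T (P ∩ closedBall 0 r₂) := by
    intro x hx
    by_cases hx0 : x = 0
    · subst hx0
      rw [ContinuousWithinAt, hT0, tendsto_iff_norm_sub_tendsto_zero]
      have hlim : Tendsto (fun y => α y * (M + ‖φ‖)) (𝓝[P ∩ closedBall 0 r₂] 0) (𝓝 0) := by
        have : Tendsto (fun y => α y * (M + ‖φ‖)) (𝓝 0) (𝓝 (α 0 * (M + ‖φ‖))) :=
          (hα.mul continuous_const).tendsto 0
        rw [hα00, zero_mul] at this
        exact this.mono_left nhdsWithin_le_nhds
      refine squeeze_zero' (Eventually.of_forall fun _ => norm_nonneg _) ?_ hlim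
      filter_upwards [self_mem_nhdsWithin] with y hy
      by_cases hy0 : y = 0
      · simp [hy0, hT0, hα00]
      · have : T y - φ = α y • (A ((α y)⁻¹ • y) - φ) := by
          simp only [T, smul_sub, sub_smul, one_smul]
          abel
        rw [this, norm_smul, Real.norm_of_nonneg (hα0 y)]
        refine mul_le_mul_of_nonneg_left ((norm_sub_le _ _).trans ?_) (hα0 y)
        gcongr
        exact hM _ (hmapK (hscale y hy hy0))
    · have hsc : ContinuousWithinAt (fun y => (α y)⁻¹ • y) ((P ∩ closedBall 0 r₂) ∩ {0}ᶜ) x :=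
        ((hα.continuousAt.inv₀ (hαpos x hx0).ne').smul continuousAt_id).continuousWithinAt
      have hA : ContinuousWithinAt (fun y => A ((α y)⁻¹ • y))
          ((P ∩ closedBall 0 r₂) ∩ {0}ᶜ) x :=
        (hcont _ (hscale x hx hx0)).comp (f := fun y => (α y)⁻¹ • y) hsc
          fun y hy => hscale y hy.1 hy.2
      refine ContinuousWithinAt.mono_of_mem_nhdsWithin
        ((hα.continuousWithinAt.smul hA).add
          ((continuous_const.sub hα).continuousWithinAt.smul continuousWithinAt_const)) ?_
      exact inter_mem self_mem_nhdsWithin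
        (mem_nhdsWithin_of_mem_nhds (isOpen_compl_singleton.mem_nhds hx0))
  have hTK : MapsTo T (P ∩ closedBall 0 r₂)
      ((fun q : ℝ × E => q.1 • q.2 + (1 - q.1) • φ) '' (Icc 0 1 ×ˢ insert 0 K)) := by
    intro x hx
    by_cases hx0 : x = 0
    · exact ⟨(0, 0), by simp, by simp [hx0, hT0]⟩
    · exact ⟨(α x, A ((α x)⁻¹ • x)),
        ⟨⟨hα0 x, hα1 x⟩, mem_insert_of_mem _ (hmapK (hscale x hx hx0))⟩, rfl⟩
  have hcpt : IsCompact
      ((fun q : ℝ × E => q.1 • q.2 + (1 - q.1) • φ) '' (Icc 0 1 ×ˢ insert 0 K)) :=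
    (isCompact_Icc.prod (hK.insert 0)).image (by fun_prop)
  have hρ : Continuous (radialRetraction r₂ : E → E) := continuous_radialRetraction hr₂
  obtain ⟨x, ⟨hxP, hx⟩, hfix⟩ := exists_fixedPoint_of_mapsTo_compact
    (hPclosed.inter isClosed_closedBall) (hPconvex.inter (convex_closedBall 0 r₂))
    ⟨0, h0P, by simp [hr₂.le]⟩ (hcpt.image hρ) (f := fun x => radialRetraction r₂ (T x))
    (hρ.comp_continuousOn hTcont)
    (fun x hx => ⟨hPsmul _ (by positivity) _ (hTP hx), by
      simpa using norm_radialRetraction_le hr₂ (T x)⟩)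
    (fun x hx => mem_image_of_mem _ (hTK hx))
  rw [mem_closedBall, dist_zero_right] at hx
  have hTx : T x = x := by
    rcases le_total ‖T x‖ r₂ with h | h
    · rwa [radialRetraction_of_norm_le hr₂ h] at hfix
    · have hxr : ‖x‖ = r₂ := by
        rw [← hfix]
        exact norm_radialRetraction_of_le hr₂ h
      have := houter x hxP hxr
      rwa [radialRetraction_of_norm_le hr₂] at hfix
      rwa [hTout x (hxr ▸ hr.le), ← hxr]
  rcases le_or_gt r₁ ‖x‖ with h | h
  · exact ⟨x, hxP, (hTout x h).symm.trans hTx, h, hx⟩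
  · exfalso
    have hx0 : x ≠ 0 := by
      rintro rfl
      exact hφ (hT0.symm.trans hTx)
    have hx' := norm_pos_iff.2 hx0
    have hαx := hαpos x hx0
    have hαlt : α x < 1 := by
      rw [hαin x h.le]
      exact (div_lt_one hr₁).2 h
    refine hinner ((α x)⁻¹ • x) (hPsmul _ (inv_nonneg.2 (hα0 x)) x hxP) ?_
      ((α x)⁻¹ * (1 - α x)) (mul_pos (inv_pos.2 hαx) (sub_pos.2 hαlt)) ?_
    · rw [norm_smul, Real.norm_of_nonneg (inv_nonneg.2 (hα0 x)), hαin x h.le]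
      field_simp
    · have hsmul := congrArg (fun z => (α x)⁻¹ • z) hTx.symm
      simpa only [T, smul_add, smul_smul, inv_mul_cancel₀ hαx.ne', one_smul] using hsmul

/-- The expansion form of the Krasnoselskii fixed point theorem, in a closed convex set stable
under nonnegative scaling. -/
theorem exists_fixedPoint_of_expansion {E : Type*} [NormedAddCommGroup E] [NormedSpace ℝ E]
    {P K : Set E} (hPclosed : IsClosed P) (hPconvex : Convex ℝ P)
    (hPsmul : ∀ c : ℝ, 0 ≤ c → ∀ x ∈ P, c • x ∈ P) {r₁ r₂ : ℝ} (hr₁ : 0 < r₁) (hr : r₁ < r₂)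
    {A : E → E} (hK : IsCompact K)
    (hmap : MapsTo A (P ∩ (closedBall 0 r₂ \ ball 0 r₁)) P)
    (hmapK : MapsTo A (P ∩ (closedBall 0 r₂ \ ball 0 r₁)) K)
    (hcont : ContinuousOn A (P ∩ (closedBall 0 r₂ \ ball 0 r₁)))
    (hinner : ∀ x ∈ P, ‖x‖ = r₁ → ‖A x‖ ≤ ‖x‖) {φ : E} (hφP : φ ∈ P) (hφ : φ ≠ 0)
    (houter : ∀ x ∈ P, ‖x‖ = r₂ → ∀ μ : ℝ, 0 < μ → x ≠ A x + μ • φ) :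
    ∃ x ∈ P, A x = x ∧ r₁ ≤ ‖x‖ ∧ ‖x‖ ≤ r₂ := by
  have hr₂ : 0 < r₂ := hr₁.trans hr
  have hann : ∀ x, x ∈ P ∩ (closedBall 0 r₂ \ ball 0 r₁) ↔ x ∈ P ∧ r₁ ≤ ‖x‖ ∧ ‖x‖ ≤ r₂ := by
    intro x
    simp only [mem_inter_iff, Set.mem_sdiff, mem_closedBall, dist_zero_right, mem_ball, not_lt]
    tauto
  let β : E → ℝ := fun x => ‖x‖ ^ 2 / (r₁ * r₂)
  have hβ : Continuous β := by fun_prop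
  have hβ0 : ∀ x, 0 ≤ β x := fun x => by positivity
  have hβpos : ∀ x, r₁ ≤ ‖x‖ → 0 < β x := fun x hx => by
    have := hr₁.trans_le hx
    positivity
  have hnorm : ∀ x, r₁ ≤ ‖x‖ → ‖(β x)⁻¹ • x‖ = r₁ * r₂ / ‖x‖ := by
    intro x hx
    have := hr₁.trans_le hx
    rw [norm_smul, Real.norm_of_nonneg (inv_nonneg.2 (hβ0 x))]
    simp only [β]
    field_simp
  have hinv : MapsTo (fun x => (β x)⁻¹ • x) (P ∩ (closedBall 0 r₂ \ ball 0 r₁))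
      (P ∩ (closedBall 0 r₂ \ ball 0 r₁)) := by
    intro x hx
    obtain ⟨hxP, h1, h2⟩ := (hann x).1 hx
    refine (hann _).2 ⟨hPsmul _ (inv_nonneg.2 (hβ0 x)) x hxP, ?_⟩
    have := hr₁.trans_le h1
    rw [hnorm x h1, le_div_iff₀ this, div_le_iff₀ this]
    constructor <;> nlinarith
  have hinvcont : ContinuousOn (fun x => (β x)⁻¹ • x)
      (P ∩ (closedBall 0 r₂ \ ball 0 r₁)) :=
    (hβ.continuousOn.inv₀ fun x hx => (hβpos x ((hann x).1 hx).2.1).ne').smul continuousOn_id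
  obtain ⟨x, hxP, hfix, h1, h2⟩ := exists_fixedPoint_of_compression hPclosed hPconvex hPsmul hr₁ hr
    (A := fun x => β x • A ((β x)⁻¹ • x))
    ((isCompact_Icc (a := (0 : ℝ)) (b := r₂ / r₁)).prod hK |>.image
      (f := fun q : ℝ × E => q.1 • q.2) (by fun_prop))
    (fun x hx => hPsmul _ (hβ0 x) _ (hmap (hinv hx)))
    (fun x hx => ⟨(β x, A ((β x)⁻¹ • x)), ⟨⟨hβ0 x, by
      obtain ⟨-, h1, h2⟩ := (hann x).1 hx
      simp only [β]
      rw [div_le_div_iff₀ (by positivity) hr₁]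
      have := pow_le_pow_left₀ (norm_nonneg x) h2 2
      nlinarith⟩, hmapK (hinv hx)⟩, rfl⟩)
    (hβ.continuousOn.smul (hcont.comp hinvcont hinv))
    (fun x hxP hx => by
      have hxr : r₁ ≤ ‖x‖ := hx ▸ hr.le
      have hn : ‖(β x)⁻¹ • x‖ = r₁ := by rw [hnorm x hxr, hx, mul_div_cancel_right₀ _ hr₂.ne']
      have := hinner _ (hPsmul _ (inv_nonneg.2 (hβ0 x)) x hxP) hn
      rw [norm_smul, Real.norm_of_nonneg (hβ0 x)]
      calc β x * ‖A ((β x)⁻¹ • x)‖ ≤ β x * ‖(β x)⁻¹ • x‖ :=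
            mul_le_mul_of_nonneg_left this (hβ0 x)
        _ = ‖x‖ := by
            rw [norm_smul, Real.norm_of_nonneg (inv_nonneg.2 (hβ0 x)),
              mul_inv_cancel_left₀ (hβpos x hxr).ne'])
    hφP hφ
    (fun x hxP hx μ hμ h => by
      have hxr : r₁ ≤ ‖x‖ := hx.ge
      refine houter ((β x)⁻¹ • x) (hPsmul _ (inv_nonneg.2 (hβ0 x)) x hxP)
        (by rw [hnorm x hxr, hx, mul_div_cancel_left₀ _ hr₁.ne'])
        ((β x)⁻¹ * μ) (mul_pos (inv_pos.2 (hβpos x hxr)) hμ) ?_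
      have hsmul := congrArg (fun z => (β x)⁻¹ • z) h
      simpa only [smul_add, smul_smul, inv_mul_cancel₀ (hβpos x hxr).ne', one_smul] using hsmul)
  obtain ⟨hyP, hy1, hy2⟩ := (hann _).1 (hinv ((hann x).2 ⟨hxP, h1, h2⟩))
  refine ⟨(β x)⁻¹ • x, hyP, ?_, hy1, hy2⟩
  have hsmul := congrArg (fun z => (β x)⁻¹ • z) hfix
  simpa only [smul_smul, inv_mul_cancel₀ (hβpos x h1).ne', one_smul] using hsmul

theorem stmt18 {B : Type*} [NormedAddCommGroup B] [NormedSpace ℝ B] [CompleteSpace B]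
    (P : Set B) (hPne : P.Nonempty) (hPclosed : IsClosed P) (hPconvex : Convex ℝ P)
    (hPsmul : ∀ c : ℝ, 0 ≤ c → ∀ x ∈ P, c • x ∈ P) (hPcone : P ∩ (-P) = {0})
    (r₁ r₂ : ℝ) (hr₁ : 0 < r₁) (hr : r₁ < r₂)
    (A : B → B)
    (hmap : Set.MapsTo A (P ∩ (Metric.closedBall 0 r₂ \ Metric.ball 0 r₁)) P)
    (hcont : ContinuousOn A (P ∩ (Metric.closedBall 0 r₂ \ Metric.ball 0 r₁)))
    (hcompact : IsCompact (closure (A '' (P ∩ (Metric.closedBall 0 r₂ \ Metric.ball 0 r₁)))))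
    (hC : ((∀ x ∈ P, ‖x‖ = r₁ → ‖A x‖ ≤ ‖x‖) ∧
            (∃ φ ∈ P, φ ≠ 0 ∧ ∀ x ∈ P, ‖x‖ = r₂ → ∀ μ : ℝ, 0 < μ → x ≠ A x + μ • φ)) ∨
          ((∀ x ∈ P, ‖x‖ = r₂ → ‖A x‖ ≤ ‖x‖) ∧
            (∃ φ ∈ P, φ ≠ 0 ∧ ∀ x ∈ P, ‖x‖ = r₁ → ∀ μ : ℝ, 0 < μ → x ≠ A x + μ • φ))) :
    ∃ x ∈ P, A x = x ∧ r₁ ≤ ‖x‖ ∧ ‖x‖ ≤ r₂ := by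
  have hmapK : MapsTo A (P ∩ (Metric.closedBall 0 r₂ \ Metric.ball 0 r₁))
      (closure (A '' (P ∩ (Metric.closedBall 0 r₂ \ Metric.ball 0 r₁)))) := fun _ hx =>
    subset_closure (mem_image_of_mem A hx)
  rcases hC with ⟨hinner, φ, hφP, hφ, houter⟩ | ⟨houter, φ, hφP, hφ, hinner⟩
  · exact exists_fixedPoint_of_expansion hPclosed hPconvex hPsmul hr₁ hr hcompact hmap hmapK hcont
      hinner hφP hφ houter
  · exact exists_fixedPoint_of_compression hPclosed hPconvex hPsmul hr₁ hr hcompact hmap hmapK hcont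
      houter hφP hφ hinner
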